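/- Let m ∈ ℝ², σ_1, σ_2 > 0 and ρ ∈ (-1,1), and let μ be the bivariate Gaussian measure on ℝ² with mean m and covariance matrix Σ = [[σ_1², ρσ_1σ_2],[ρσ_1σ_2, σ_2²]] (realized, e.g., as the pushforward of the product of two standard real Gaussian measures under the affine map (x,z) ↦ (m_1 + σ_1 x, m_2 + σ_2(ρ x + √(1-ρ²) z))). Then the infimum of the Kullback–Leibler divergence KL(μ ‖ ν) over all measures ν that are products of two one-dimensional Gaussian measures on ℝ (arbitrary means, positive variances) equals -(1/2) log(1-ρ²), and it is attained at the product Gaussian ν with mean m and variances σ_1², σ_2². -/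

import Mathlib

open Real MeasureTheory ProbabilityTheory

/-- Real-valued Kullback–Leibler divergence `KL(μ ‖ ν) = ∫ log(dμ/dν) dμ`. -/
noncomputable def klReal (μ ν : Measure (ℝ × ℝ)) : ℝ :=
  ∫ x, Real.log ((μ.rnDeriv ν x).toReal) ∂μ

/-- The bivariate Gaussian measure with mean `m`, standard deviations `σ₁, σ₂` and
correlation `ρ`, realized as the pushforward of the product of two standard Gaussians. -/
noncomputable def biGauss (m : ℝ × ℝ) (σ1 σ2 ρ : ℝ) : Measure (ℝ × ℝ) :=
  Measure.map
    (fun xz : ℝ × ℝ =>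
      (m.1 + σ1 * xz.1, m.2 + σ2 * (ρ * xz.1 + Real.sqrt (1 - ρ ^ 2) * xz.2)))
    ((gaussianReal 0 1).prod (gaussianReal 0 1))

lemma gaussianReal_map_affine (a σ : ℝ) :
    (gaussianReal 0 1).map (fun x => a + σ * x) = gaussianReal a (σ ^ 2).toNNReal := by
  have h : (fun x : ℝ => a + σ * x) = (a + ·) ∘ (σ * ·) := rfl
  rw [h, ← Measure.map_map (by fun_prop) (by fun_prop), gaussianReal_map_const_mul,
    gaussianReal_map_const_add]
  congr 1
  · simp
  · ext
    simp [sq_nonneg]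

lemma lintegral_gaussianReal_affine (a : ℝ) {σ : ℝ} (hσ : σ ≠ 0) {g : ℝ → ENNReal}
    (hg : Measurable g) :
    ∫⁻ x, g (a + σ * x) ∂(gaussianReal 0 1)
      = ∫⁻ x, gaussianPDF a (σ ^ 2).toNNReal x * g x := by
  have hv : (σ ^ 2).toNNReal ≠ 0 := by
    simpa using hσ
  rw [← lintegral_map (f := g) (g := fun x => a + σ * x) hg (by fun_prop),
    gaussianReal_map_affine, gaussianReal_of_var_ne_zero _ hv,
    lintegral_withDensity_eq_lintegral_mul _ (measurable_gaussianPDF _ _) hg]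
  rfl

lemma log_gaussianPDFReal (a : ℝ) {v : NNReal} (hv : 0 < v) (x : ℝ) :
    Real.log (gaussianPDFReal a v x)
      = -(1 / 2) * Real.log (2 * π) - (1 / 2) * Real.log v - (x - a) ^ 2 / (2 * v) := by
  have hv' : (0 : ℝ) < v := hv
  rw [gaussianPDFReal, Real.log_mul (by positivity) (by positivity), Real.log_exp, Real.log_inv,
    Real.log_sqrt (by positivity), Real.log_mul (by positivity) (by positivity)]
  ring

/-- The Lebesgue density of the bivariate Gaussian measure, as the product of the density of the
first marginal and of the conditional density of the second coordinate. -/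
noncomputable def biGaussPDF (m : ℝ × ℝ) (σ1 σ2 ρ : ℝ) (p : ℝ × ℝ) : ENNReal :=
  gaussianPDF m.1 (σ1 ^ 2).toNNReal p.1 *
    gaussianPDF (m.2 + σ2 * ρ * ((p.1 - m.1) / σ1)) ((σ2 * √(1 - ρ ^ 2)) ^ 2).toNNReal p.2

lemma measurable_biGaussPDF (m : ℝ × ℝ) (σ1 σ2 ρ : ℝ) : Measurable (biGaussPDF m σ1 σ2 ρ) := by
  unfold biGaussPDF gaussianPDF gaussianPDFReal
  fun_prop

lemma biGauss_eq_withDensity (m : ℝ × ℝ) {σ1 σ2 ρ : ℝ} (h1 : σ1 ≠ 0)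
    (hs : σ2 * √(1 - ρ ^ 2) ≠ 0) :
    biGauss m σ1 σ2 ρ = volume.withDensity (biGaussPDF m σ1 σ2 ρ) := by
  refine Measure.ext_of_lintegral _ fun f hf => ?_
  rw [biGauss, lintegral_map hf (by fun_prop), lintegral_prod _ (by fun_prop),
    lintegral_withDensity_eq_lintegral_mul _ (measurable_biGaussPDF _ _ _ _) hf,
    Measure.volume_eq_prod,
    lintegral_prod _ ((measurable_biGaussPDF _ _ _ _).mul hf).aemeasurable]
  have hinner (x : ℝ) : ∫⁻ z, f (m.1 + σ1 * x, m.2 + σ2 * (ρ * x + √(1 - ρ ^ 2) * z))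
        ∂(gaussianReal 0 1) = ∫⁻ y, gaussianPDF (m.2 + σ2 * ρ * (((m.1 + σ1 * x) - m.1) / σ1))
          ((σ2 * √(1 - ρ ^ 2)) ^ 2).toNNReal y * f (m.1 + σ1 * x, y) := by
    rw [← lintegral_gaussianReal_affine _ hs (g := fun y => f (m.1 + σ1 * x, y)) (by fun_prop)]
    refine lintegral_congr fun z => ?_
    congr 2
    field_simp
    ring
  have hmeas : Measurable fun p : ℝ × ℝ => gaussianPDF (m.2 + σ2 * ρ * ((p.1 - m.1) / σ1))
      ((σ2 * √(1 - ρ ^ 2)) ^ 2).toNNReal p.2 * f (p.1, p.2) := by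
    unfold gaussianPDF gaussianPDFReal
    fun_prop
  simp_rw [hinner]
  rw [lintegral_gaussianReal_affine m.1 h1 (g := fun x => ∫⁻ y, gaussianPDF
    (m.2 + σ2 * ρ * ((x - m.1) / σ1)) ((σ2 * √(1 - ρ ^ 2)) ^ 2).toNNReal y * f (x, y))
    hmeas.lintegral_prod_right']
  refine lintegral_congr fun x => ?_
  refine (lintegral_const_mul _ (hmeas.comp (measurable_prodMk_left (x := x)))).symm.trans ?_
  simp only [biGaussPDF, Pi.mul_apply, mul_assoc, Function.comp_apply]

lemma gaussianReal_prod_eq_withDensity (a b : ℝ) {v1 v2 : NNReal} (hv1 : v1 ≠ 0) (hv2 : v2 ≠ 0) :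
    (gaussianReal a v1).prod (gaussianReal b v2)
      = volume.withDensity fun p : ℝ × ℝ => gaussianPDF a v1 p.1 * gaussianPDF b v2 p.2 := by
  rw [gaussianReal_of_var_ne_zero _ hv1, gaussianReal_of_var_ne_zero _ hv2,
    prod_withDensity (measurable_gaussianPDF _ _) (measurable_gaussianPDF _ _),
    Measure.volume_eq_prod]

lemma integral_sq_gaussianReal : ∫ x, x ^ 2 ∂(gaussianReal 0 1) = 1 := by
  have h := variance_fun_id_gaussianReal (μ := 0) (v := 1)
  rw [variance_of_integral_eq_zero (by fun_prop) (by simp)] at h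
  simpa using h

lemma integral_quadratic_gaussianReal_prod (A B C D E F : ℝ) :
    ∫ p : ℝ × ℝ, (A + B * p.1 + C * p.2 + D * p.1 ^ 2 + E * (p.1 * p.2) + F * p.2 ^ 2)
      ∂((gaussianReal 0 1).prod (gaussianReal 0 1)) = A + D + F := by
  have i1 : Integrable (fun x : ℝ => x) (gaussianReal 0 1) :=
    (memLp_id_gaussianReal 1).integrable (by norm_num)
  have i2 : Integrable (fun x : ℝ => x ^ 2) (gaussianReal 0 1) :=
    (memLp_id_gaussianReal 2).integrable_sq
  have e1 := (i1.comp_fst (gaussianReal 0 1)).const_mul B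
  have e2 := (i1.comp_snd (gaussianReal 0 1)).const_mul C
  have e3 := (i2.comp_fst (gaussianReal 0 1)).const_mul D
  have e4 := (i1.mul_prod i1).const_mul E
  have e5 := (i2.comp_snd (gaussianReal 0 1)).const_mul F
  have e0 := integrable_const (μ := (gaussianReal 0 1).prod (gaussianReal 0 1)) A
  rw [integral_add ((((e0.fun_add e1).fun_add e2).fun_add e3).fun_add e4) e5,
    integral_add (((e0.fun_add e1).fun_add e2).fun_add e3) e4, integral_add ((e0.fun_add e1).fun_add e2) e3,
    integral_add (e0.fun_add e1) e2, integral_add e0 e1]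
  simp only [integral_const_mul]
  rw [integral_prod_mul (fun x : ℝ => x) (fun x : ℝ => x),
    integral_fun_fst (fun x : ℝ => x), integral_fun_snd (fun x : ℝ => x),
    integral_fun_fst (fun x : ℝ => x ^ 2), integral_fun_snd (fun x : ℝ => x ^ 2),
    integral_sq_gaussianReal]
  simp

lemma log_rnDeriv_biGauss (m : ℝ × ℝ) {σ1 σ2 ρ : ℝ} (h1 : 0 < σ1)
    (hs : 0 < σ2 * √(1 - ρ ^ 2)) (a b : ℝ) {v1 v2 : NNReal} (hv1 : 0 < v1) (hv2 : 0 < v2) :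
    ∀ᵐ p ∂(biGauss m σ1 σ2 ρ),
      Real.log ((biGauss m σ1 σ2 ρ).rnDeriv
        ((gaussianReal a v1).prod (gaussianReal b v2)) p).toReal
      = Real.log (gaussianPDFReal m.1 (σ1 ^ 2).toNNReal p.1)
        + Real.log (gaussianPDFReal (m.2 + σ2 * ρ * ((p.1 - m.1) / σ1))
            ((σ2 * √(1 - ρ ^ 2)) ^ 2).toNNReal p.2)
        - Real.log (gaussianPDFReal a v1 p.1) - Real.log (gaussianPDFReal b v2 p.2) := by
  have hw1 : (σ1 ^ 2).toNNReal ≠ 0 := by simpa using h1.ne'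
  have hw2 : ((σ2 * √(1 - ρ ^ 2)) ^ 2).toNNReal ≠ 0 := by
    rw [ne_eq, Real.toNNReal_eq_zero, not_le]
    positivity
  have hprob : IsProbabilityMeasure (biGauss m σ1 σ2 ρ) :=
    Measure.isProbabilityMeasure_map (by fun_prop)
  have hμ := biGauss_eq_withDensity m h1.ne' hs.ne'
  have hac : biGauss m σ1 σ2 ρ ≪ volume := by
    rw [hμ]
    exact withDensity_absolutelyContinuous _ _
  have hright := Measure.rnDeriv_withDensity_right (biGauss m σ1 σ2 ρ) volume
    (f := fun p : ℝ × ℝ => gaussianPDF a v1 p.1 * gaussianPDF b v2 p.2)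
    (by unfold gaussianPDF gaussianPDFReal; fun_prop)
    (ae_of_all _ fun p => mul_ne_zero (gaussianPDF_pos _ hv1.ne' _).ne'
      (gaussianPDF_pos _ hv2.ne' _).ne')
    (ae_of_all _ fun p => ENNReal.mul_ne_top gaussianPDF_ne_top gaussianPDF_ne_top)
  have hleft := Measure.rnDeriv_withDensity volume (measurable_biGaussPDF m σ1 σ2 ρ)
  rw [← hμ] at hleft
  rw [gaussianReal_prod_eq_withDensity a b hv1.ne' hv2.ne']
  filter_upwards [hac.ae_le hright, hac.ae_le hleft] with p hp hp'
  have q1 := (gaussianPDFReal_pos m.1 _ p.1 hw1).ne'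
  have q2 := (gaussianPDFReal_pos (m.2 + σ2 * ρ * ((p.1 - m.1) / σ1)) _ p.2 hw2).ne'
  have q3 := (gaussianPDFReal_pos a _ p.1 hv1.ne').ne'
  have q4 := (gaussianPDFReal_pos b _ p.2 hv2.ne').ne'
  rw [hp, hp', biGaussPDF]
  simp only [ENNReal.toReal_mul, ENNReal.toReal_inv, toReal_gaussianPDF]
  rw [Real.log_mul (inv_ne_zero (mul_ne_zero q3 q4)) (mul_ne_zero q1 q2), Real.log_inv,
    Real.log_mul q3 q4, Real.log_mul q1 q2]
  ring

/-- Closed form of the divergence of a bivariate Gaussian from a product of Gaussians. -/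
lemma klReal_biGauss_prod (m : ℝ × ℝ) {σ1 σ2 ρ : ℝ} (h1 : 0 < σ1) (h2 : 0 < σ2)
    (hρ : ρ ∈ Set.Ioo (-1 : ℝ) 1) (a b : ℝ) {v1 v2 : NNReal} (hv1 : 0 < v1) (hv2 : 0 < v2) :
    klReal (biGauss m σ1 σ2 ρ) ((gaussianReal a v1).prod (gaussianReal b v2))
      = -(1 / 2) * Real.log (1 - ρ ^ 2)
        + (1 / 2) * (σ1 ^ 2 / v1 - 1 - Real.log (σ1 ^ 2 / v1) + (m.1 - a) ^ 2 / v1)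
        + (1 / 2) * (σ2 ^ 2 / v2 - 1 - Real.log (σ2 ^ 2 / v2) + (m.2 - b) ^ 2 / v2) := by
  have hr : 0 < 1 - ρ ^ 2 := by nlinarith [hρ.1, hρ.2]
  obtain ⟨s, hs⟩ : ∃ s, s = √(1 - ρ ^ 2) := ⟨_, rfl⟩
  have hs0 : 0 < s := hs ▸ Real.sqrt_pos.2 hr
  have hs2 : s ^ 2 = 1 - ρ ^ 2 := hs ▸ Real.sq_sqrt hr.le
  have hv1' : (0 : ℝ) < v1 := hv1
  have hv2' : (0 : ℝ) < v2 := hv2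
  have hw1 : 0 < (σ1 ^ 2).toNNReal := Real.toNNReal_pos.2 (by positivity)
  have hw2 : 0 < ((σ2 * s) ^ 2).toNNReal := Real.toNNReal_pos.2 (by positivity)
  rw [klReal, integral_congr_ae
    (log_rnDeriv_biGauss m h1 (mul_pos h2 (hs ▸ hs0)) a b hv1 hv2), ← hs]
  simp_rw [log_gaussianPDFReal _ hw1, log_gaussianPDFReal _ hw2, log_gaussianPDFReal _ hv1,
    log_gaussianPDFReal _ hv2, Real.coe_toNNReal _ (sq_nonneg _)]
  rw [biGauss, integral_map (by fun_prop) (by fun_prop), ← hs]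
  rw [Real.log_div (by positivity) (by positivity), Real.log_div (by positivity) (by positivity),
    ← hs2]
  trans ∫ p : ℝ × ℝ,
      ((-(1 / 2) * Real.log (s ^ 2) + (1 / 2) * (Real.log v1 - Real.log (σ1 ^ 2))
          + (1 / 2) * (Real.log v2 - Real.log (σ2 ^ 2))
          + (m.1 - a) ^ 2 / (2 * v1) + (m.2 - b) ^ 2 / (2 * v2))
        + ((m.1 - a) * σ1 / v1 + (m.2 - b) * σ2 * ρ / v2) * p.1
        + ((m.2 - b) * σ2 * s / v2) * p.2
        + (-(1 / 2) + σ1 ^ 2 / (2 * v1) + (σ2 * ρ) ^ 2 / (2 * v2)) * p.1 ^ 2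
        + (σ2 ^ 2 * ρ * s / v2) * (p.1 * p.2)
        + (-(1 / 2) + (σ2 * s) ^ 2 / (2 * v2)) * p.2 ^ 2)
      ∂((gaussianReal 0 1).prod (gaussianReal 0 1))
  · refine integral_congr_ae (ae_of_all _ fun p => ?_)
    have k1 : (m.1 + σ1 * p.1 - m.1) / σ1 = p.1 := by field_simp; ring
    have k3 : Real.log ((σ2 * s) ^ 2) = Real.log (σ2 ^ 2) + Real.log (s ^ 2) := by
      rw [mul_pow, Real.log_mul (by positivity) (by positivity)]
    simp only [k1, k3]
    field_simp
    ring
  · rw [integral_quadratic_gaussianReal_prod]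
    have k2 : (σ2 * s) ^ 2 = σ2 ^ 2 - (σ2 * ρ) ^ 2 := by rw [mul_pow, hs2]; ring
    rw [k2]
    field_simp
    ring

theorem stmt_18 (m : ℝ × ℝ) (σ1 σ2 : ℝ) (h1 : 0 < σ1) (h2 : 0 < σ2)
    (ρ : ℝ) (hρ : ρ ∈ Set.Ioo (-1 : ℝ) 1) :
    (∀ (a b : ℝ) (v1 v2 : NNReal), 0 < v1 → 0 < v2 →
      -(1 / 2) * Real.log (1 - ρ ^ 2) ≤
        klReal (biGauss m σ1 σ2 ρ) ((gaussianReal a v1).prod (gaussianReal b v2))) ∧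
    klReal (biGauss m σ1 σ2 ρ)
        ((gaussianReal m.1 ((σ1 ^ 2).toNNReal)).prod (gaussianReal m.2 ((σ2 ^ 2).toNNReal)))
      = -(1 / 2) * Real.log (1 - ρ ^ 2) := by
  constructor
  · intro a b v1 v2 hv1 hv2
    have hv1' : (0 : ℝ) < v1 := hv1
    have hv2' : (0 : ℝ) < v2 := hv2
    rw [klReal_biGauss_prod m h1 h2 hρ a b hv1 hv2]
    have l1 := Real.log_le_sub_one_of_pos (x := σ1 ^ 2 / v1) (by positivity)
    have l2 := Real.log_le_sub_one_of_pos (x := σ2 ^ 2 / v2) (by positivity)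
    have q1 : 0 ≤ (m.1 - a) ^ 2 / v1 := by positivity
    have q2 : 0 ≤ (m.2 - b) ^ 2 / v2 := by positivity
    linarith
  · rw [klReal_biGauss_prod m h1 h2 hρ _ _ (Real.toNNReal_pos.2 (by positivity))
      (Real.toNNReal_pos.2 (by positivity)), Real.coe_toNNReal _ (sq_nonneg _),
      Real.coe_toNNReal _ (sq_nonneg _), div_self (by positivity), div_self (by positivity)]
    simp
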